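/- Assume 0 < q < 1/2, so q < p. Then the attack-cycle length L is finite almost surely and E[L] = 1 + p²q/(p − q). -/

import Mathlib

open MeasureTheory ProbabilityTheory Filter Finset

/-- Partial sums of the walk: `walkS X n ω = X 1 ω + ⋯ + X n ω`. -/
noncomputable def walkS {Ω : Type*} (X : ℕ → Ω → ℤ) (n : ℕ) (ω : Ω) : ℤ :=
  ∑ i ∈ Finset.Icc 1 n, X i ω

/-- The stopping time `τ = inf {n ≥ 3 : S_n = 1}` (`sInf ∅ = 0` by convention). -/
noncomputable def cycleTau {Ω : Type*} (X : ℕ → Ω → ℤ) (ω : Ω) : ℕ :=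
  sInf {n : ℕ | 3 ≤ n ∧ walkS X n ω = 1}

/-- The number `L` of official blocks added by an attack cycle. -/
noncomputable def cycleL {Ω : Type*} (X : ℕ → Ω → ℤ) (ω : Ω) : ℕ :=
  if X 1 ω = -1 then 1 else if X 2 ω = -1 then 2 else (cycleTau X ω + 1) / 2

/-- The stopped walk: position above level `1` from time `2` on, zero once stopped. -/
def stopW (x : ℕ → ℤ) : ℕ → ℤ
  | 0 => if x 1 = 1 ∧ x 2 = 1 then 1 else 0
  | n + 1 => stopW x n + (if stopW x n = 0 then 0 else x (n + 3))

lemma stopW_congr (x y : ℕ → ℤ) (n : ℕ) (h : ∀ i ∈ Finset.Icc 1 (n + 2), x i = y i) :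
    stopW x n = stopW y n := by
  induction n with
  | zero =>
    have h1 := h 1 (by simp)
    have h2 := h 2 (by simp)
    simp [stopW, h1, h2]
  | succ n ih =>
    have h1 := ih (fun i hi => h i (by simp at hi ⊢; omega))
    have h2 := h (n + 3) (by simp)
    simp [stopW, h1, h2]

lemma stopW_bounds (x : ℕ → ℤ) (hx : ∀ i, x i = 1 ∨ x i = -1) (n : ℕ) :
    0 ≤ stopW x n ∧ stopW x n ≤ n + 1 := by
  induction n with
  | zero => simp only [stopW]; split_ifs <;> simp
  | succ n ih =>
    simp only [stopW]
    rcases hx (n + 3) with h | h <;> split_ifs <;> push_cast <;> omega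

lemma walkS_succ' {Ω : Type*} (X : ℕ → Ω → ℤ) (n : ℕ) (ω : Ω) :
    walkS X (n + 1) ω = walkS X n ω + X (n + 1) ω := by
  unfold walkS
  rw [Finset.sum_Icc_succ_top (by omega)]

lemma walkS_parity {Ω : Type*} (X : ℕ → Ω → ℤ) (ω : Ω) (hx : ∀ i, X i ω = 1 ∨ X i ω = -1)
    (n : ℕ) : ∃ k : ℤ, walkS X n ω = n + 2 * k := by
  induction n with
  | zero => exact ⟨0, by simp [walkS]⟩
  | succ n ih =>
    obtain ⟨k, hk⟩ := ih
    rw [walkS_succ', hk]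
    rcases hx (n + 1) with h | h
    · exact ⟨k, by rw [h]; push_cast; ring⟩
    · exact ⟨k - 1, by rw [h]; push_cast; ring⟩

lemma stopW_eq {Ω : Type*} (X : ℕ → Ω → ℤ) (ω : Ω) (h1 : X 1 ω = 1) (h2 : X 2 ω = 1) (n : ℕ)
    (hn : ∀ k, 3 ≤ k → k < n + 2 → walkS X k ω ≠ 1) :
    stopW (fun i => X i ω) n = walkS X (n + 2) ω - 1 := by
  induction n with
  | zero =>
    have : walkS X 2 ω = X 1 ω + X 2 ω := by
      rw [walkS_succ', walkS_succ']; simp [walkS]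
    simp [stopW, h1, h2, this]
  | succ n ih =>
    have ih' := ih (fun k hk hk' => hn k hk (by omega))
    have hne : stopW (fun i => X i ω) n ≠ 0 := by
      rcases Nat.eq_zero_or_pos n with rfl | hpos
      · simp [stopW, h1, h2]
      · have := hn (n + 2) (by omega) (by omega)
        rw [ih']; omega
    simp only [stopW, if_neg hne]
    rw [ih', show n + 1 + 2 = (n + 2) + 1 by ring, walkS_succ' X (n + 2)]
    ring

lemma stopW_zero_mono (x : ℕ → ℤ) (n m : ℕ) (h : n ≤ m) (h0 : stopW x n = 0) :
    stopW x m = 0 := by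
  induction m, h using Nat.le_induction with
  | base => exact h0
  | succ m _ ih => simp [stopW, ih]

lemma stopW_exists {Ω : Type*} (X : ℕ → Ω → ℤ) (ω : Ω) (h1 : X 1 ω = 1) (h2 : X 2 ω = 1)
    (h : ∃ n, stopW (fun i => X i ω) n = 0) : ∃ n : ℕ, 3 ≤ n ∧ walkS X n ω = 1 := by
  by_contra hcon
  push Not at hcon
  obtain ⟨n, hn⟩ := h
  have := stopW_eq X ω h1 h2 n (fun k hk _ => hcon k hk)
  rcases Nat.eq_zero_or_pos n with rfl | hpos
  · simp [stopW, h1, h2] at hn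
  · exact hcon (n + 2) (by omega) (by omega)

lemma two_cycleL {Ω : Type*} (X : ℕ → Ω → ℤ) (ω : Ω) (hx : ∀ i, X i ω = 1 ∨ X i ω = -1)
    (h1 : X 1 ω = 1) (h2 : X 2 ω = 1)
    (h : ∃ n : ℕ, 3 ≤ n ∧ walkS X n ω = 1) :
    (2 * (cycleL X ω : ENNReal)) =
      3 + ∑' n, (if stopW (fun i => X i ω) n = 0 then (0 : ENNReal) else 1) := by
  have hmem : 3 ≤ cycleTau X ω ∧ walkS X (cycleTau X ω) ω = 1 := Nat.sInf_mem h
  have hmin : ∀ k, 3 ≤ k → k < cycleTau X ω → walkS X k ω ≠ 1 := by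
    intro k hk hlt he
    exact Nat.notMem_of_lt_sInf hlt ⟨hk, he⟩
  have hL : cycleL X ω = (cycleTau X ω + 1) / 2 := by
    simp [cycleL, h1, h2]
  obtain ⟨t, ht⟩ : ∃ t, cycleTau X ω = t + 2 := ⟨cycleTau X ω - 2, by omega⟩
  obtain ⟨k, hk⟩ := walkS_parity X ω hx (cycleTau X ω)
  have h2L : 2 * cycleL X ω = 3 + t := by
    rw [hL]; omega
  have hiff : ∀ n, stopW (fun i => X i ω) n = 0 ↔ t ≤ n := by
    intro n
    constructor
    · intro h0
      by_contra hlt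
      have := stopW_eq X ω h1 h2 n (fun k hk hk' => hmin k hk (by omega))
      rcases Nat.eq_zero_or_pos n with rfl | hpos
      · simp [stopW, h1, h2] at h0
      · exact hmin (n + 2) (by omega) (by omega) (by omega)
    · intro hle
      apply stopW_zero_mono _ t n hle
      have := stopW_eq X ω h1 h2 t (fun k hk hk' => hmin k hk (by omega))
      rw [this, ← ht, hmem.2]; simp
  have hs : ∑' n, (if stopW (fun i => X i ω) n = 0 then (0 : ENNReal) else 1) = t := by
    rw [tsum_eq_sum (s := Finset.range t)]
    · rw [Finset.sum_congr rfl (g := fun _ => (1 : ENNReal))]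
      · simp
      · intro n hn
        rw [if_neg]
        rw [hiff]; simpa using hn
    · intro n hn
      rw [if_pos]
      rw [hiff]; simpa using hn
  rw [hs]
  exact_mod_cast h2L

lemma seq_hasSum (a m v : ℕ → ℝ) (d c : ℝ) (hd : 0 < d) (ha : ∀ n, 0 ≤ a n) (hm : ∀ n, 0 ≤ m n)
    (hv : ∀ n, 0 ≤ v n) (hm0 : m 0 = c) 
    (hms : ∀ n, m (n + 1) = m n - d * a n)
    (hvs : ∀ n, v (n + 1) = v n - 2 * d * m n + a n) : HasSum a (c / d) := by
  have h1 : ∀ N, ∑ k ∈ Finset.range N, a k = (c - m N) / d := by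
    intro N
    induction N with
    | zero => simp [hm0]
    | succ N ih => rw [Finset.sum_range_succ, ih, hms]; field_simp; ring
  have h2 : ∀ N, ∑ k ∈ Finset.range N, m k = (v 0 - v N + ∑ k ∈ Finset.range N, a k) / (2 * d) := by
    intro N
    induction N with
    | zero => simp
    | succ N ih =>
      rw [Finset.sum_range_succ, ih, Finset.sum_range_succ, hvs]; field_simp; ring
  have hsm : Summable m := by
    apply summable_of_sum_range_le (c := (v 0 + c / d) / (2 * d)) hm
    intro N
    rw [h2, h1]
    have := hv N
    have := hm N
    gcongr
    · linarith
    · linarith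
  have ht := hsm.tendsto_atTop_zero
  rw [hasSum_iff_tendsto_nat_of_nonneg ha]
  simp_rw [h1]
  have := (ht.const_sub c).div_const d
  simpa using this

section prob

variable {Ω : Type*} [MeasureSpace Ω] [IsProbabilityMeasure (ℙ : Measure Ω)]

lemma stopW_indep (X : ℕ → Ω → ℤ) (hmeas : ∀ i, Measurable (X i))
    (hindep : iIndepFun X ℙ) (n : ℕ) :
    Measurable (fun ω => stopW (fun i => X i ω) n) ∧
    IndepFun (fun ω => stopW (fun i => X i ω) n) (X (n + 3)) ℙ := by
  let g : ((Finset.Icc 1 (n + 2)) → ℤ) → ℤ := fun y =>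
    stopW (fun i => if h : i ∈ Finset.Icc 1 (n + 2) then y ⟨i, h⟩ else 0) n
  have hg : (fun ω => stopW (fun i => X i ω) n) =
      g ∘ (fun ω (i : Finset.Icc 1 (n + 2)) => X i ω) := by
    funext ω
    apply stopW_congr
    intro i hi
    simp only [dif_pos hi]
  have hgm : Measurable g := Measurable.of_discrete
  constructor
  · rw [hg]
    exact hgm.comp (measurable_pi_lambda _ (fun i => hmeas i))
  · have h := hindep.indepFun_finset (Finset.Icc 1 (n + 2)) {n + 3}
      (by simp) hmeas
    have h2 := h.comp hgm (measurable_pi_apply (⟨n + 3, by simp⟩ : ({n + 3} : Finset ℕ)))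
    rw [hg]
    exact h2

lemma good_ae (q p : ℝ) (hq : 0 < q) (hq1 : q < 1 / 2) (hp : p = 1 - q)
    (X : ℕ → Ω → ℤ) (hmeas : ∀ i, Measurable (X i))
    (hup : ∀ i, ℙ {ω | X i ω = 1} = ENNReal.ofReal q)
    (hdown : ∀ i, ℙ {ω | X i ω = -1} = ENNReal.ofReal p) :
    ∀ᵐ ω ∂(ℙ : Measure Ω), ∀ i, X i ω = 1 ∨ X i ω = -1 := by
  rw [ae_all_iff]
  intro i
  have hm1 : MeasurableSet {ω | X i ω = 1} := hmeas i (measurableSet_singleton 1)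
  have hm2 : MeasurableSet {ω | X i ω = -1} := hmeas i (measurableSet_singleton (-1))
  have hu : ℙ ({ω | X i ω = 1} ∪ {ω | X i ω = -1}) = 1 := by
    rw [measure_union _ hm2, hup, hdown, ← ENNReal.ofReal_add hq.le (by linarith), hp]
    · simp
    · rw [Set.disjoint_left]
      intro ω h1 h2
      simp only [Set.mem_setOf_eq] at h1 h2
      omega
  have := (mem_ae_iff_prob_eq_one (hm1.union hm2)).2 hu
  filter_upwards [this] with ω hω using hω

lemma integral_X (q p : ℝ) (hq : 0 < q) (hq1 : q < 1 / 2) (hp : p = 1 - q)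
    (X : ℕ → Ω → ℤ) (hmeas : ∀ i, Measurable (X i))
    (hup : ∀ i, ℙ {ω | X i ω = 1} = ENNReal.ofReal q)
    (hdown : ∀ i, ℙ {ω | X i ω = -1} = ENNReal.ofReal p) (i : ℕ) :
    ∫ ω, (X i ω : ℝ) ∂(ℙ : Measure Ω) = q - p := by
  have hm1 : MeasurableSet {ω | X i ω = 1} := hmeas i (measurableSet_singleton 1)
  have hm2 : MeasurableSet {ω | X i ω = -1} := hmeas i (measurableSet_singleton (-1))
  have : (fun ω => (X i ω : ℝ)) =ᵐ[ℙ] fun ω => {ω | X i ω = 1}.indicator (fun _ => (1 : ℝ)) ω -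
      {ω | X i ω = -1}.indicator (fun _ => (1 : ℝ)) ω := by
    filter_upwards [good_ae q p hq hq1 hp X hmeas hup hdown] with ω hω
    rcases hω i with h | h <;> simp [Set.indicator, h]
  rw [integral_congr_ae this, integral_sub, integral_indicator_const _ hm1,
    integral_indicator_const _ hm2]
  · simp [Measure.real, hup, hdown, ENNReal.toReal_ofReal hq.le,
      ENNReal.toReal_ofReal (show 0 ≤ p by linarith)]
  · exact (integrable_const _).indicator hm1
  · exact (integrable_const _).indicator hm2

lemma stop_hasSum (q p : ℝ) (hq : 0 < q) (hq1 : q < 1 / 2) (hp : p = 1 - q)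
    (X : ℕ → Ω → ℤ) (hmeas : ∀ i, Measurable (X i))
    (hindep : iIndepFun X ℙ)
    (hup : ∀ i, ℙ {ω | X i ω = 1} = ENNReal.ofReal q)
    (hdown : ∀ i, ℙ {ω | X i ω = -1} = ENNReal.ofReal p)
    (hHH : ℙ {ω | X 1 ω = 1 ∧ X 2 ω = 1} = ENNReal.ofReal (q ^ 2)) :
    HasSum (fun n => ∫ ω, (if stopW (fun i => X i ω) n = 0 then (0 : ℝ) else 1) ∂(ℙ : Measure Ω))
      (q ^ 2 / (p - q)) := by
  have hgood := good_ae q p hq hq1 hp X hmeas hup hdown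
  have hWm := fun n => (stopW_indep X hmeas hindep n).1
  have hWi := fun n => (stopW_indep X hmeas hindep n).2
  have hfm : ∀ (f : ℤ → ℝ) n, Measurable (fun ω => f (stopW (fun i => X i ω) n)) :=
    fun f n => (Measurable.of_discrete (f := f)).comp (hWm n)
  have hXm : ∀ i, Measurable (fun ω => (X i ω : ℝ)) :=
    fun i => (Measurable.of_discrete (f := fun z : ℤ => (z : ℝ))).comp (hmeas i)
  have hfi : ∀ (f : ℤ → ℝ) n, Integrable (fun ω => f (stopW (fun i => X i ω) n)) ℙ := by
    intro f n
    refine Integrable.of_bound (hfm f n).aestronglyMeasurable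
      (∑ k ∈ Finset.Icc (0 : ℤ) (n + 1), ‖f k‖) ?_
    filter_upwards [hgood] with ω hω
    have := stopW_bounds (fun i => X i ω) hω n
    exact Finset.single_le_sum (f := fun k => ‖f k‖) (fun _ _ => norm_nonneg _)
      (by simpa using this)
  have hmul : ∀ (f : ℤ → ℝ) n, ∫ ω, f (stopW (fun i => X i ω) n) * (X (n + 3) ω : ℝ) ∂(ℙ : Measure Ω)
      = (∫ ω, f (stopW (fun i => X i ω) n) ∂(ℙ : Measure Ω)) * (q - p) := by
    intro f n
    have h := (hWi n).comp (Measurable.of_discrete (f := f))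
      (Measurable.of_discrete (f := fun z : ℤ => (z : ℝ)))
    have := h.integral_fun_mul_eq_mul_integral (hfm f n).aestronglyMeasurable
      (hXm (n + 3)).aestronglyMeasurable
    simp only [Function.comp_apply] at this
    rw [this, integral_X q p hq hq1 hp X hmeas hup hdown]
  have hmuli : ∀ (f : ℤ → ℝ) n,
      Integrable (fun ω => f (stopW (fun i => X i ω) n) * (X (n + 3) ω : ℝ)) ℙ := by
    intro f n
    refine (hfi f n).mul_bdd (c := 1) (hXm (n + 3)).aestronglyMeasurable ?_
    filter_upwards [hgood] with ω hω
    rcases hω (n + 3) with h | h <;> simp [h]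
  refine seq_hasSum _ (fun n => ∫ ω, (stopW (fun i => X i ω) n : ℝ) ∂(ℙ : Measure Ω))
    (fun n => ∫ ω, (stopW (fun i => X i ω) n : ℝ) ^ 2 ∂(ℙ : Measure Ω)) (p - q) (q ^ 2)
    (by linarith) ?_ ?_ ?_ ?_ ?_ ?_
  · intro n
    apply integral_nonneg
    intro ω
    dsimp only
    split_ifs <;> simp
  · intro n
    apply integral_nonneg_of_ae
    filter_upwards [hgood] with ω hω
    have := (stopW_bounds (fun i => X i ω) hω n).1
    simpa using this
  · intro n
    apply integral_nonneg
    intro ω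
    positivity
  · have hms : MeasurableSet {ω | X 1 ω = 1 ∧ X 2 ω = 1} :=
      (hmeas 1 (measurableSet_singleton 1)).inter (hmeas 2 (measurableSet_singleton 1))
    have : (fun ω => (stopW (fun i => X i ω) 0 : ℝ)) =
        {ω | X 1 ω = 1 ∧ X 2 ω = 1}.indicator (fun _ => (1 : ℝ)) := by
      funext ω
      simp [stopW, Set.indicator]
    simp only [this]
    rw [integral_indicator_const _ hms]
    simp [Measure.real, hHH, ENNReal.toReal_ofReal (sq_nonneg q)]
  · intro n
    have e : ∀ ω, (stopW (fun i => X i ω) (n + 1) : ℝ) = (stopW (fun i => X i ω) n : ℝ) +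
        (if stopW (fun i => X i ω) n = 0 then (0 : ℝ) else 1) * (X (n + 3) ω : ℝ) := by
      intro ω
      simp only [stopW]
      split_ifs <;> simp
    simp only [e]
    rw [integral_add (hfi (fun z => (z : ℝ)) n) (hmuli (fun z => if z = 0 then 0 else 1) n),
      hmul (fun z => if z = 0 then 0 else 1) n]
    ring
  · intro n
    have e : (fun ω => (stopW (fun i => X i ω) (n + 1) : ℝ) ^ 2) =ᵐ[ℙ]
        fun ω => ((stopW (fun i => X i ω) n : ℝ) ^ 2 +
        (2 * (stopW (fun i => X i ω) n : ℝ)) * (X (n + 3) ω : ℝ)) +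
        (if stopW (fun i => X i ω) n = 0 then (0 : ℝ) else 1) := by
      filter_upwards [hgood] with ω hω
      simp only [stopW]
      rcases hω (n + 3) with h | h <;> split_ifs with h0 <;> simp [h, h0] <;> ring
    have hi : Integrable (fun ω => (stopW (fun i => X i ω) n : ℝ) ^ 2 +
        (2 * (stopW (fun i => X i ω) n : ℝ)) * (X (n + 3) ω : ℝ)) ℙ :=
      (hfi (fun z => (z : ℝ) ^ 2) n).add (hmuli (fun z => 2 * (z : ℝ)) n)
    rw [integral_congr_ae e, integral_add hi
      (hfi (fun z => if z = 0 then 0 else 1) n),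
      integral_add (hfi (fun z => (z : ℝ) ^ 2) n) (hmuli (fun z => 2 * (z : ℝ)) n),
      hmul (fun z => 2 * (z : ℝ)) n, integral_const_mul]
    ring

end prob

theorem stmt2 {Ω : Type*} [MeasureSpace Ω] [IsProbabilityMeasure (ℙ : Measure Ω)]
    (q p : ℝ) (hq : 0 < q) (hq1 : q < 1 / 2) (hp : p = 1 - q)
    (X : ℕ → Ω → ℤ) (hmeas : ∀ i, Measurable (X i))
    (hindep : iIndepFun X ℙ)
    (hup : ∀ i, ℙ {ω | X i ω = 1} = ENNReal.ofReal q)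
    (hdown : ∀ i, ℙ {ω | X i ω = -1} = ENNReal.ofReal p) :
    (∀ᵐ ω ∂(ℙ : Measure Ω),
        (X 1 ω = 1 ∧ X 2 ω = 1) → ∃ n : ℕ, 3 ≤ n ∧ walkS X n ω = 1) ∧
    ∫⁻ ω, (cycleL X ω : ENNReal) ∂(ℙ : Measure Ω)
      = ENNReal.ofReal (1 + p ^ 2 * q / (p - q)) := by
  have hpq : 0 < p - q := by linarith
  have hp0 : 0 < p := by linarith
  have hgood := good_ae q p hq hq1 hp X hmeas hup hdown
  have h12 : IndepFun (X 1) (X 2) ℙ := hindep.indepFun (by norm_num)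
  have hHH : ℙ {ω | X 1 ω = 1 ∧ X 2 ω = 1} = ENNReal.ofReal (q ^ 2) := by
    have := h12.measure_inter_preimage_eq_mul {1} {1} (measurableSet_singleton _)
      (measurableSet_singleton _)
    have e : {ω | X 1 ω = 1 ∧ X 2 ω = 1} = X 1 ⁻¹' {1} ∩ X 2 ⁻¹' {1} := rfl
    rw [e, this, pow_two, ENNReal.ofReal_mul hq.le]
    exact congrArg₂ _ (hup 1) (hup 2)
  have hHT : ℙ {ω | X 1 ω = 1 ∧ X 2 ω = -1} = ENNReal.ofReal (q * p) := by
    have := h12.measure_inter_preimage_eq_mul {1} {-1} (measurableSet_singleton _)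
      (measurableSet_singleton _)
    have e : {ω | X 1 ω = 1 ∧ X 2 ω = -1} = X 1 ⁻¹' {1} ∩ X 2 ⁻¹' {-1} := rfl
    rw [e, this, ENNReal.ofReal_mul hq.le]
    exact congrArg₂ _ (hup 1) (hdown 2)
  have hmT : MeasurableSet {ω | X 1 ω = -1} := hmeas 1 (measurableSet_singleton (-1))
  have hmHH : MeasurableSet {ω | X 1 ω = 1 ∧ X 2 ω = 1} :=
    (hmeas 1 (measurableSet_singleton 1)).inter (hmeas 2 (measurableSet_singleton 1))
  have hmHT : MeasurableSet {ω | X 1 ω = 1 ∧ X 2 ω = -1} :=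
    (hmeas 1 (measurableSet_singleton 1)).inter (hmeas 2 (measurableSet_singleton (-1)))
  have hsum := stop_hasSum q p hq hq1 hp X hmeas hindep hup hdown hHH
  have hWm := fun n => (stopW_indep X hmeas hindep n).1
  have hIm : ∀ n, Measurable
      (fun ω => if stopW (fun i => X i ω) n = 0 then (0 : ENNReal) else 1) :=
    fun n => (Measurable.of_discrete (f := fun z : ℤ => if z = 0 then (0 : ENNReal) else 1)).comp
      (hWm n)
  have hIr : ∀ n, Measurable
      (fun ω => if stopW (fun i => X i ω) n = 0 then (0 : ℝ) else 1) :=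
    fun n => (Measurable.of_discrete (f := fun z : ℤ => if z = 0 then (0 : ℝ) else 1)).comp
      (hWm n)
  have hconv : ∀ n, ∫⁻ ω, (if stopW (fun i => X i ω) n = 0 then (0 : ENNReal) else 1)
      ∂(ℙ : Measure Ω) = ENNReal.ofReal
        (∫ ω, (if stopW (fun i => X i ω) n = 0 then (0 : ℝ) else 1) ∂(ℙ : Measure Ω)) := by
    intro n
    rw [ofReal_integral_eq_lintegral_ofReal]
    · apply lintegral_congr
      intro ω
      split_ifs <;> simp
    · refine Integrable.of_bound (hIr n).aestronglyMeasurable 1 (ae_of_all _ fun ω => ?_)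
      split_ifs <;> simp
    · refine ae_of_all _ fun ω => ?_
      dsimp only
      split_ifs <;> simp
  have htot : ∫⁻ ω, ∑' n, (if stopW (fun i => X i ω) n = 0 then (0 : ENNReal) else 1)
      ∂(ℙ : Measure Ω) = ENNReal.ofReal (q ^ 2 / (p - q)) := by
    rw [lintegral_tsum (fun n => (hIm n).aemeasurable)]
    simp_rw [hconv]
    rw [← ENNReal.ofReal_tsum_of_nonneg _ hsum.summable, hsum.tsum_eq]
    intro n
    apply integral_nonneg
    intro ω
    dsimp only
    split_ifs <;> simp
  have hfin : ∀ᵐ ω ∂(ℙ : Measure Ω), ∃ n, stopW (fun i => X i ω) n = 0 := by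
    have := ae_lt_top (Measurable.ennreal_tsum hIm) (by rw [htot]; exact ENNReal.ofReal_ne_top)
    filter_upwards [this] with ω hω
    by_contra hcon
    push Not at hcon
    simp [hcon] at hω
  have hex : ∀ᵐ ω ∂(ℙ : Measure Ω),
        (X 1 ω = 1 ∧ X 2 ω = 1) → ∃ n : ℕ, 3 ≤ n ∧ walkS X n ω = 1 := by
    filter_upwards [hfin] with ω hω h
    exact stopW_exists X ω h.1 h.2 hω
  refine ⟨hex, ?_⟩
  have hae : (fun ω => 2 * (cycleL X ω : ENNReal)) =ᵐ[ℙ] fun ω =>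
      {ω | X 1 ω = -1}.indicator (fun _ => (2 : ENNReal)) ω +
      ({ω | X 1 ω = 1 ∧ X 2 ω = -1}.indicator (fun _ => (4 : ENNReal)) ω +
      ({ω | X 1 ω = 1 ∧ X 2 ω = 1}.indicator (fun _ => (3 : ENNReal)) ω +
       ∑' n, (if stopW (fun i => X i ω) n = 0 then (0 : ENNReal) else 1))) := by
    filter_upwards [hgood, hex] with ω hω hx
    have hz : ¬ (X 1 ω = 1 ∧ X 2 ω = 1) →
        ∑' n, (if stopW (fun i => X i ω) n = 0 then (0 : ENNReal) else 1) = 0 := by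
      intro h
      have h0 : stopW (fun i => X i ω) 0 = 0 := by simp only [stopW]; rw [if_neg h]
      simp [fun n => stopW_zero_mono (fun i => X i ω) 0 n (Nat.zero_le n) h0]
    rcases hω 1 with h1 | h1
    · rcases hω 2 with h2 | h2
      · rw [two_cycleL X ω hω h1 h2 (hx ⟨h1, h2⟩)]
        simp [Set.indicator, h1, h2]
      · rw [hz (by simp [h2])]
        simp [Set.indicator, h1, h2, cycleL]
        norm_num
    · rw [hz (by simp [h1])]
      simp [Set.indicator, h1, cycleL]
  have h2I : 2 * ∫⁻ ω, (cycleL X ω : ENNReal) ∂(ℙ : Measure Ω) =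
      2 * ENNReal.ofReal (1 + p ^ 2 * q / (p - q)) := by
    rw [← lintegral_const_mul' _ _ (by simp), lintegral_congr_ae hae,
      lintegral_add_left (measurable_const.indicator hmT),
      lintegral_add_left (measurable_const.indicator hmHT),
      lintegral_add_left (measurable_const.indicator hmHH), htot,
      lintegral_indicator_const hmT, lintegral_indicator_const hmHT,
      lintegral_indicator_const hmHH, hdown, hHT, hHH]
    have c2 : (2 : ENNReal) = ENNReal.ofReal 2 := by simp
    have c3 : (3 : ENNReal) = ENNReal.ofReal 3 := by simp
    have c4 : (4 : ENNReal) = ENNReal.ofReal 4 := by simp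
    rw [c2, c3, c4, ← ENNReal.ofReal_mul (by norm_num), ← ENNReal.ofReal_mul (by norm_num),
      ← ENNReal.ofReal_mul (by norm_num), ← ENNReal.ofReal_mul (by norm_num),
      ← ENNReal.ofReal_add (by positivity) (by positivity),
      ← ENNReal.ofReal_add (by positivity) (by positivity),
      ← ENNReal.ofReal_add (by positivity) (by positivity)]
    congr 1
    subst hp
    field_simp
    ring
  exact (ENNReal.mul_right_inj (by simp) (by simp)).1 h2I
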